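/- Let ρ be a law invariant risk measure with induced divergence α. Let E and F be Polish spaces, let μ, ν ∈ 𝓟(E) with ν absolutely continuous with respect to μ, and let T : E → F be measurable such that the Radon–Nikodym density dν/dμ is measurable with respect to σ(T), i.e., dν/dμ = g∘T μ-a.e. for some measurable g : F → ℝ. Then α(ν∘T⁻¹ | μ∘T⁻¹) = α(ν|μ). -/

import Mathlib

open MeasureTheory ProbabilityTheory Filter Topology
open scoped ENNReal NNReal

noncomputable section

namespace RiskDiv

/-- A bounded measurable real-valued function (a representative of an element of `L^∞`). -/
def BddMeas {E : Type*} [MeasurableSpace E] (f : E → ℝ) : Prop :=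
  Measurable f ∧ ∃ M : ℝ, ∀ x, |f x| ≤ M

/-- A (normalized, convex, monotone, cash-additive) risk measure on `L^∞(E, μ)`,
viewed as a functional on bounded measurable functions which respects a.e. equality. -/
structure IsRiskMeasure {E : Type*} [MeasurableSpace E] (μ : Measure E)
    (ρ : (E → ℝ) → ℝ) : Prop where
  mono : ∀ f g : E → ℝ, BddMeas f → BddMeas g → (∀ᵐ x ∂μ, f x ≤ g x) → ρ f ≤ ρ g
  cash : ∀ (f : E → ℝ) (c : ℝ), BddMeas f → ρ (fun x => f x + c) = ρ f + c
  norm0 : ρ (fun _ => 0) = 0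
  cvx : ∀ (f g : E → ℝ) (t : ℝ), BddMeas f → BddMeas g → 0 ≤ t → t ≤ 1 →
    ρ (fun x => t * f x + (1 - t) * g x) ≤ t * ρ f + (1 - t) * ρ g
  congr_ae : ∀ f g : E → ℝ, BddMeas f → BddMeas g → (∀ᵐ x ∂μ, f x = g x) → ρ f = ρ g

/-- Law invariance: `ρ` only depends on the distribution of its argument. -/
def LawInvariant {E : Type*} [MeasurableSpace E] (μ : Measure E) (ρ : (E → ℝ) → ℝ) : Prop :=
  ∀ f g : E → ℝ, BddMeas f → BddMeas g → μ.map f = μ.map g → ρ f = ρ g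

open Classical in
/-- `ρ_μ(f) := ρ(f ∘ X)` where `X` is any random variable with law `μ` (this is well defined,
independently of the choice of `X`, when `ρ` is law invariant). -/
def rhoMu {Ω : Type*} [MeasurableSpace Ω] (P : Measure Ω) (ρ : (Ω → ℝ) → ℝ)
    {E : Type*} [MeasurableSpace E] (μ : Measure E) (f : E → ℝ) : ℝ :=
  if h : ∃ X : Ω → E, Measurable X ∧ P.map X = μ then ρ (f ∘ h.choose) else 0

/-- The divergence induced by `ρ`:
`α(ν|μ) := sup { ∫ f dν − ρ_μ(f) : f bounded measurable } ∈ [0,∞]`. -/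
def divergence {Ω : Type*} [MeasurableSpace Ω] (P : Measure Ω) (ρ : (Ω → ℝ) → ℝ)
    {E : Type*} [MeasurableSpace E] (ν μ : Measure E) : ℝ≥0∞ :=
  ⨆ (f : E → ℝ) (_ : BddMeas f), ENNReal.ofReal ((∫ x, f x ∂ν) - rhoMu P ρ μ f)

/-- The divergence induced by `ρ` is simplified if, on `[0,1]`, the supremum defining it can be
restricted to continuous functions. -/
def Simplified {Ω : Type*} [MeasurableSpace Ω] (P : Measure Ω) (ρ : (Ω → ℝ) → ℝ) : Prop :=
  ∀ μ ν : Measure (Set.Icc (0:ℝ) 1), IsProbabilityMeasure μ → IsProbabilityMeasure ν →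
    divergence P ρ ν μ =
      ⨆ (f : (Set.Icc (0:ℝ) 1) → ℝ) (_ : Continuous f),
        ENNReal.ofReal ((∫ x, f x ∂ν) - rhoMu P ρ μ f)

open unitInterval in
lemma exists_unif {Ω : Type*} [MeasurableSpace Ω] [StandardBorelSpace Ω]
    (P : Measure Ω) [IsProbabilityMeasure P] [NullSingletonClass P] :
    ∃ U : Ω → I, Measurable U ∧ P.map U = volume := by
  have he := measurableEmbedding_embeddingReal Ω
  set e := embeddingReal Ω
  set Q := P.map e with hQ
  have hQp : IsProbabilityMeasure Q := Measure.isProbabilityMeasure_map he.measurable.aemeasurable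
  have hat : ∀ a : ℝ, Q {a} = 0 := by
    intro a
    rw [hQ, he.map_apply]
    have hs : (e ⁻¹' {a}).Subsingleton := Set.subsingleton_singleton.preimage he.injective
    exact hs.measure_zero P
  have hcont : Continuous (cdf Q) := by
    rw [continuous_iff_continuousAt]
    intro a
    rw [(monotone_cdf Q).continuousAt_iff_leftLim_eq_rightLim, StieltjesFunction.rightLim_eq]
    have h1 := (cdf Q).measure_singleton a
    rw [measure_cdf, hat] at h1
    have h2 := ENNReal.ofReal_eq_zero.1 h1.symm
    exact le_antisymm ((monotone_cdf Q).leftLim_le le_rfl) (by linarith)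
  have ivt : ∀ y : ℝ, 0 < y → y < 1 → ∃ s, cdf Q s = y := by
    intro y h0 h1
    apply mem_range_of_exists_le_of_exists_ge hcont
    · exact (((tendsto_cdf_atBot Q).eventually (eventually_lt_nhds h0)).exists).imp fun _ h => h.le
    · exact (((tendsto_cdf_atTop Q).eventually (eventually_gt_nhds h1)).exists).imp fun _ h => h.le
  have hUm : Measurable (fun ω => (⟨cdf Q (e ω), cdf_nonneg _ _, cdf_le_one _ _⟩ : I)) :=
    (hcont.measurable.comp he.measurable).subtype_mk
  refine ⟨_, hUm, ?_⟩
  have : IsProbabilityMeasure (P.map (fun ω => (⟨cdf Q (e ω), cdf_nonneg _ _, cdf_le_one _ _⟩ : I))) :=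
    Measure.isProbabilityMeasure_map hUm.aemeasurable
  refine Measure.ext_of_Iic _ _ fun x => ?_
  rw [Measure.map_apply hUm measurableSet_Iic, unitInterval.volume_Iic]
  have heq : (fun ω => (⟨cdf Q (e ω), cdf_nonneg _ _, cdf_le_one _ _⟩ : I)) ⁻¹' Set.Iic x
      = e ⁻¹' {s | cdf Q s ≤ x} := by
    ext ω; simp [← Subtype.coe_le_coe]
  rw [heq, ← he.map_apply]
  change Q _ = _
  apply le_antisymm
  · rcases eq_or_lt_of_le x.2.2 with h | h
    · rw [h]; simpa using prob_le_one
    · have key : ∀ y : ℝ, (x:ℝ) < y → y < 1 → Q.real {s | cdf Q s ≤ x} ≤ y := by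
        intro y h1 h2
        obtain ⟨s, hs⟩ := ivt y (x.2.1.trans_lt h1) h2
        rw [← hs, cdf_eq_real Q]
        refine measureReal_mono ?_ (measure_ne_top _ _)
        intro r hr
        by_contra hc
        have : cdf Q s ≤ cdf Q r := monotone_cdf Q (not_le.1 hc).le
        have hr' : cdf Q r ≤ x := hr
        linarith
      rw [← ofReal_measureReal]
      apply ENNReal.ofReal_le_ofReal
      exact le_of_forall_gt_imp_ge_of_dense (fun a ha => by
        by_cases h1 : a < 1
        · exact key a ha h1
        · exact measureReal_le_one.trans (not_lt.1 h1))
  · rcases eq_or_lt_of_le x.2.1 with h | h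
    · rw [← h]; simp
    rcases eq_or_lt_of_le x.2.2 with h' | h'
    · have : {s | cdf Q s ≤ x} = Set.univ := by
        ext s; simp [h', cdf_le_one]
      rw [this]; simp [h']
    · obtain ⟨s, hs⟩ := ivt x h h'
      rw [← hs, ofReal_cdf]
      apply measure_mono
      intro r hr
      exact monotone_cdf Q hr

lemma exists_law {Ω : Type*} [MeasurableSpace Ω] [StandardBorelSpace Ω]
    (P : Measure Ω) [IsProbabilityMeasure P] [NullSingletonClass P]
    {Y : Type*} [MeasurableSpace Y] [StandardBorelSpace Y] (μ : Measure Y) [IsProbabilityMeasure μ] :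
    ∃ X : Ω → Y, Measurable X ∧ P.map X = μ := by
  obtain ⟨U, hU, hU'⟩ := exists_unif P
  have : Nonempty Y := nonempty_of_isProbabilityMeasure μ
  obtain ⟨f, hf, hf'⟩ := μ.exists_measurable_map_eq
  exact ⟨f ∘ U, hf.comp hU, by rw [← Measure.map_map hf hU, hU', hf']⟩

def rot (a : ℝ) (u : unitInterval) : unitInterval :=
  ⟨Int.fract ((u : ℝ) + a), Int.fract_nonneg _, (Int.fract_lt_one _).le⟩

lemma measurable_rot (a : ℝ) : Measurable (rot a) := by
  apply Measurable.subtype_mk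
  exact measurable_fract.comp (measurable_subtype_coe.add_const a)

lemma map_rot (a : ℝ) : (volume : Measure unitInterval).map (rot a) = volume := by
  let ι : unitInterval → UnitAddCircle := fun u => ((u : ℝ) : UnitAddCircle)
  have hιm : Measurable ι := AddCircle.measurable_mk'.comp measurable_subtype_coe
  have hι : (volume : Measure unitInterval).map ι = volume := by
    have h1 := (UnitAddCircle.measurePreserving_mk 0).map_eq
    change Measure.map ((fun x : ℝ => (x : UnitAddCircle)) ∘ Subtype.val) _ = _
    rw [← Measure.map_map (g := fun x : ℝ => (x : UnitAddCircle)) AddCircle.measurable_mk'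
      measurable_subtype_coe, unitInterval.measurePreserving_coe.map_eq, ← h1]
    congr 1
    rw [zero_add]
    exact (restrict_Ioc_eq_restrict_Icc).symm
  let θ : UnitAddCircle → unitInterval := fun c =>
    ⟨(AddCircle.equivIco 1 0 c : ℝ), (AddCircle.equivIco 1 0 c).2.1,
      by have := (AddCircle.equivIco 1 0 c).2.2; linarith⟩
  have hθm : Measurable θ := by
    apply Measurable.subtype_mk
    exact measurable_subtype_coe.comp (AddCircle.measurableEquivIco 1 0).measurable
  have hr : ∀ b, rot b = fun u => θ (ι u + (b : UnitAddCircle)) := by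
    intro b
    ext u
    have := AddCircle.coe_equivIco_mk_apply (p := (1:ℝ)) ((u:ℝ) + b)
    simp only [div_one, mul_one] at this
    exact this.symm
  have hθ : (volume : Measure UnitAddCircle).map θ = volume := by
    rw [← hι, Measure.map_map hθm hιm]
    have : θ ∘ ι =ᵐ[volume] id := by
      have : ∀ᵐ u : unitInterval, u ≠ 1 := by
        rw [ae_iff]; simp
      filter_upwards [this] with u hu
      have := congrFun (hr 0) u
      simp only [AddCircle.coe_zero, add_zero] at this
      rw [Function.comp, ← this]
      ext
      simp only [rot, add_zero, id]
      rw [Int.fract_eq_self]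
      exact ⟨u.2.1, lt_of_le_of_ne u.2.2 (fun h => hu (Subtype.ext h))⟩
    rw [Measure.map_congr this, Measure.map_id]
  rw [hr]
  have h3 : (fun u => θ (ι u + (a : UnitAddCircle))) = θ ∘ (fun c => c + (a : UnitAddCircle)) ∘ ι := rfl
  rw [h3, ← Measure.map_map hθm ((measurable_add_const _).comp hιm), ← Measure.map_map (measurable_add_const _) hιm,
    hι, map_add_right_eq_self, hθ]

lemma periodic_aux (n : ℕ) (hn : 0 < n) (w : ℝ → ℝ) :
    Function.Periodic (fun x => ∑ j ∈ Finset.range n, w (Int.fract (x + j / n))) (1 / n) := by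
  intro x
  have hn' : (n:ℝ) ≠ 0 := by positivity
  have h1 := Finset.sum_range_succ (fun j : ℕ => w (Int.fract (x + j / n))) n
  have h2 := Finset.sum_range_succ' (fun j : ℕ => w (Int.fract (x + j / n))) n
  have h3 : Int.fract (x + (n:ℝ) / n) = Int.fract x := by
    rw [div_self hn', Int.fract_add_one]
  simp only [h3] at h1
  simp only [Nat.cast_zero, zero_div, add_zero] at h2
  rw [h1] at h2
  have h4 := add_right_cancel h2
  dsimp only
  rw [h4]
  apply Finset.sum_congr rfl
  intro j _
  congr 2
  push_cast
  ring

lemma riemann_aux (n : ℕ) (hn : 0 < n) (w : ℝ → ℝ) (hw : Monotone w) (h0 : ∀ x, 0 ≤ w x)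
    (h1 : ∀ x, w x ≤ 1) (x : ℝ) :
    (∑ j ∈ Finset.range n, w (j / n)) ≤ ∑ j ∈ Finset.range n, w (Int.fract (x + j / n)) ∧
    (∑ j ∈ Finset.range n, w (Int.fract (x + j / n))) ≤ (∑ j ∈ Finset.range n, w (j / n)) + 1 := by
  have hn' : (0:ℝ) < n := by positivity
  have hp := (periodic_aux n hn w).sub_zsmul_eq ⌊n * x⌋ (x := x)
  set y := x - ⌊n * x⌋ • (1 / (n:ℝ)) with hy
  have hy' : y = Int.fract (n * x) / n := by
    rw [hy, Int.fract, zsmul_eq_mul]; field_simp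
  rw [← hp]
  have hy0 : 0 ≤ y := by rw [hy']; exact div_nonneg (Int.fract_nonneg _) hn'.le
  have hy1 : y < 1 / n := by rw [hy']; exact div_lt_div_of_pos_right (Int.fract_lt_one _) hn'
  have hf : ∀ j ∈ Finset.range n, Int.fract (y + (j:ℝ) / n) = y + j / n := by
    intro j hj
    rw [Int.fract_eq_self]
    constructor
    · positivity
    · have : (j:ℝ) + 1 ≤ n := by exact_mod_cast Finset.mem_range.1 hj
      calc y + j / n < 1 / n + j / n := by linarith
        _ = (j + 1) / n := by ring
        _ ≤ 1 := by rw [div_le_one hn']; exact this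
  have hsum : ∑ j ∈ Finset.range n, w (Int.fract (y + (j:ℝ) / n)) =
      ∑ j ∈ Finset.range n, w (y + (j:ℝ) / n) :=
    Finset.sum_congr rfl (fun j hj => by rw [hf j hj])
  rw [hsum]
  constructor
  · exact Finset.sum_le_sum fun j _ => hw (by linarith)
  · have a1 := Finset.sum_range_succ (fun j : ℕ => w (j / n)) n
    have a2 := Finset.sum_range_succ' (fun j : ℕ => w (j / n)) n
    have : ∑ j ∈ Finset.range n, w (y + j / n) ≤ ∑ j ∈ Finset.range n, w (((j + 1 : ℕ) : ℝ) / n) := by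
      refine Finset.sum_le_sum fun j _ => hw ?_
      push_cast
      rw [add_div]; linarith
    have b1 := h1 ((n:ℝ)/n)
    have b2 := h0 (((0:ℕ):ℝ)/n)
    linarith

lemma rot_avg (n : ℕ) (hn : 0 < n) (v : unitInterval → unitInterval) (hv : Monotone v)
    (u : unitInterval) :
    |(1 / (n:ℝ)) * ∑ j ∈ Finset.range n, (v (rot (j / n) u) : ℝ) - ∫ s, (v s : ℝ)| ≤ 1 / n := by
  have hn' : (0:ℝ) < n := by positivity
  let w : ℝ → ℝ := fun x => v (Set.projIcc 0 1 zero_le_one x)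
  have hw : Monotone w := fun a b h => hv (Set.monotone_projIcc _ h)
  have key := riemann_aux n hn w hw (fun x => (v _).2.1) (fun x => (v _).2.2)
  have hwr : ∀ (s : unitInterval) (j : ℕ), w (Int.fract (s + (j:ℝ) / n)) = v (rot (j / n) s) := by
    intro s j
    simp only [w]
    congr 2
    exact Set.projIcc_of_mem zero_le_one (rot (j/n) s).2
  have key' : ∀ s : unitInterval, _ := fun s => key s
  simp only [hwr] at key'
  set A := ∑ j ∈ Finset.range n, w (j / n)
  have hvm : Measurable v := hv.measurable
  have hintg : ∀ a, Integrable (fun s => (v (rot a s) : ℝ)) := by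
    intro a
    refine Integrable.of_bound (C := 1) ((measurable_subtype_coe.comp (hvm.comp (measurable_rot a))).aestronglyMeasurable) ?_
    refine Eventually.of_forall fun s => ?_
    rw [Real.norm_eq_abs, abs_of_nonneg (v _).2.1]
    exact (v _).2.2
  have hI : ∀ a, ∫ s, (v (rot a s) : ℝ) = ∫ s, (v s : ℝ) := by
    intro a
    conv_rhs => rw [← map_rot a]
    rw [integral_map (measurable_rot a).aemeasurable]
    exact (measurable_subtype_coe.comp hvm).aestronglyMeasurable
  have hS : ∫ s, ∑ j ∈ Finset.range n, (v (rot (j / n) s) : ℝ) = n * ∫ s, (v s : ℝ) := by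
    rw [integral_finsetSum _ (fun j _ => hintg _)]
    simp [hI]
  have hSi : Integrable (fun s => ∑ j ∈ Finset.range n, (v (rot (j / n) s) : ℝ)) :=
    integrable_finsetSum _ (fun j _ => hintg _)
  have l1 : A ≤ n * ∫ s, (v s : ℝ) := by
    rw [← hS]
    calc A = ∫ s : unitInterval, A := by simp
      _ ≤ _ := integral_mono (integrable_const _) hSi (fun s => (key' s).1)
  have l2 : n * ∫ s, (v s : ℝ) ≤ A + 1 := by
    rw [← hS]
    calc _ ≤ ∫ s : unitInterval, (A + 1) := integral_mono hSi (integrable_const _) (fun s => (key' s).2)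
      _ = A + 1 := by simp
  obtain ⟨k1, k2⟩ := key' u
  have : (1 / (n:ℝ)) * ∑ j ∈ Finset.range n, (v (rot (j / n) u) : ℝ) - ∫ s, (v s : ℝ)
    = (1 / n) * (∑ j ∈ Finset.range n, (v (rot (j / n) u) : ℝ) - n * ∫ s, (v s : ℝ)) := by
    field_simp
  rw [this, abs_mul, abs_of_pos (by positivity : 0 < 1 / (n:ℝ))]
  refine mul_le_of_le_one_right (by positivity) ?_
  rw [abs_le]; constructor <;> linarith



open Set unitInterval Function in
/-- Jointly measurable quantile function of a kernel into the unit interval. -/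
lemma exists_quantile {X : Type*} [MeasurableSpace X] (κ : Kernel X unitInterval) [IsMarkovKernel κ] :
    ∃ (f : X → unitInterval → unitInterval), Measurable (Function.uncurry f) ∧
      (∀ a, Monotone (f a)) ∧ ∀ a, (volume : Measure unitInterval).map (f a) = κ a := by
  let f := fun s (t : I) ↦ sSup {x | (κ s).real (Icc 0 x) < t}
  have measurable_f : Measurable (uncurry f) := by
    refine measurable_of_Ioi fun a ↦ ?_
    simp only [preimage, uncurry, mem_Ioi]
    have h_monotone s : Monotone (fun x ↦ (κ s).real (Icc 0 x)) :=
      fun x y hxy ↦ measureReal_mono (by gcongr)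
    have sSup_eq_iUnion_rat : {x : X × I | a < f x.1 x.2} =
        ⋃ (q : ℚ) (hqI : ↑q ∈ I) (_ : a < (q : ℝ)), {e | (κ e.1).real (Icc 0 ⟨q, hqI⟩) < e.2} := by
      ext e
      simp_all only [lt_sSup_iff, mem_ofPred_eq, Subtype.exists, mem_Icc, Rat.cast_nonneg,
        mem_iUnion, exists_prop, exists_and_left, f]
      constructor
      · rintro ⟨y, hyI, y_mem, (hy : a.1 < y)⟩
        obtain ⟨q, hqa, hqy⟩ := exists_rat_btwn hy
        refine ⟨q, hqa, ⟨?_, hqy.le.trans hyI.2⟩, lt_of_lt_of_le' y_mem (h_monotone e.1 hqy.le)⟩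
        simp [← Rat.cast_nonneg (K := ℝ), a.2.1.trans hqa.le]
      · intro he
        obtain ⟨q, hqa, hqI, h⟩ := he
        refine ⟨q, ⟨by simp [hqI.1], hqI.2⟩, h, ?_⟩
        change a.1 < q
        simp [hqa]
    rw [sSup_eq_iUnion_rat]
    refine MeasurableSet.iUnion (fun b ↦ MeasurableSet.iUnion
      (fun bI ↦ MeasurableSet.iUnion (fun _ ↦ ?_)))
    refine measurableSet_lt ?_ measurable_snd.subtype_val
    simp_rw [measureReal_def]
    have hκ := κ.measurable_coe (s := Icc 0 ⟨b, bI⟩) measurableSet_Icc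
    fun_prop
  refine ⟨f, measurable_f, fun a t t' htt => sSup_le_sSup fun x (hx : _ < (t:ℝ)) =>
    show _ < (t':ℝ) from lt_of_lt_of_le hx htt,
    fun a ↦ (volume.map (f a)).ext_of_Iic (κ a) fun x ↦ ?_⟩
  have Iic_to_Icc : Iic x = Icc 0 x := by ext; simp
  have κ_in_I : ((κ a).real (Icc 0 x)) ∈ I := ⟨measureReal_nonneg, measureReal_le_one⟩
  simp_rw [volume.map_apply measurable_f.of_uncurry_left measurableSet_Iic, preimage,
    mem_Iic, Iic_to_Icc, ← ofReal_measureReal (measure_ne_top (κ a) _), ← volume_Iic ⟨_, κ_in_I⟩]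
  congr with ξ
  constructor
  · intro (hξ : f a ξ ≤ x)
    change ξ ≤ (κ a).real (Icc 0 x)
    by_cases hx : x = 1
    · simp [hx, ← univ_eq_Icc, ξ.2.2]
    let g := fun y ↦ (κ a).real (Icc 0 y)
    let nebot : NeBot (𝓝[>] x) := by
      refine nhdsGT_neBot_of_exists_gt ?_
      use 1
      exact lt_of_le_of_ne x.2.2 hx
    refine le_of_tendsto_of_tendsto (b := 𝓝[>] x) (g := g) continuousWithinAt_const ?_ ?_
    · let h := cdf ((κ a).map Subtype.val)
      have h_continuousWithinAt := continuousWithinAt_Ioi_iff_Ici.mpr (h.right_continuous x)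
      simp_rw [g, ← unitInterval.cdf_eq_real (κ a)]
      exact h_continuousWithinAt.comp (Continuous.continuousWithinAt (by fun_prop)) (fun y hy ↦ hy)
    · refine eventually_nhdsWithin_of_forall fun y hy ↦ ?_
      by_contra! h
      simp only [sSup_le_iff, f] at hξ
      specialize hξ y h
      grind
  · intro (hξ : ξ ≤ (κ a).real (Icc 0 x))
    simp only [sSup_le_iff, f]
    intro c hc
    by_contra! h
    have h_lt : ¬ (κ a).real (Icc 0 x) ≤ (κ a).real (Icc 0 c) := not_le.mpr (lt_of_le_of_lt' hξ hc)
    refine h_lt ?_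
    gcongr
    simp

/-- Disintegration with a monotone quantile function, in terms of `lintegral`. -/
lemma exists_quantile_rep {E F : Type*} [MeasurableSpace E] [MeasurableSpace F]
    (μ : Measure E) [IsProbabilityMeasure μ] (T : E → F) (hT : Measurable T)
    (φ : E → unitInterval) (hφ : Measurable φ) :
    ∃ q : F → unitInterval → unitInterval, Measurable (Function.uncurry q) ∧
      (∀ a, Monotone (q a)) ∧ ∀ K : F × unitInterval → ℝ≥0∞, Measurable K →
        ∫⁻ x, K (T x, φ x) ∂μ = ∫⁻ x, ∫⁻ u, K (T x, q (T x) u) ∂volume ∂μ := by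
  obtain ⟨q, hq, hm, hmap⟩ := exists_quantile (condDistrib φ T μ)
  refine ⟨q, hq, hm, fun K hK => ?_⟩
  have h := compProd_map_condDistrib (mβ := inferInstance) (μ := μ) (X := T) hφ.aemeasurable
  have e1 : ∫⁻ x, K (T x, φ x) ∂μ = ∫⁻ p, K p ∂(μ.map fun a ↦ (T a, φ a)) := by
    rw [lintegral_map hK (by fun_prop)]
  have hq' : ∀ a, Measurable (q a) := fun a => hq.of_uncurry_left
  rw [e1, ← h, Measure.lintegral_compProd hK, lintegral_map _ hT]
  · refine lintegral_congr fun x => ?_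
    rw [← hmap, lintegral_map (by fun_prop) (hq' _)]
  · exact hK.lintegral_kernel_prod_right'

lemma rep_nu {E F : Type*} [MeasurableSpace E] [MeasurableSpace F]
    (μ ν : Measure E) [IsProbabilityMeasure μ] [IsProbabilityMeasure ν] (hac : ν ≪ μ)
    (T : E → F) (hT : Measurable T) (g : F → ℝ) (hg : Measurable g)
    (hsuff : ∀ᵐ x ∂μ, ν.rnDeriv μ x = ENNReal.ofReal (g (T x)))
    (φ : E → unitInterval) (hφ : Measurable φ) (q : F → unitInterval → unitInterval)
    (hq : Measurable (Function.uncurry q))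
    (H : ∀ K : F × unitInterval → ℝ≥0∞, Measurable K →
        ∫⁻ x, K (T x, φ x) ∂μ = ∫⁻ x, ∫⁻ u, K (T x, q (T x) u) ∂volume ∂μ)
    (K : F × unitInterval → ℝ≥0∞) (hK : Measurable K) :
        ∫⁻ x, K (T x, φ x) ∂ν = ∫⁻ x, ∫⁻ u, K (T x, q (T x) u) ∂volume ∂ν := by
  have hν : ν = μ.withDensity (fun x => ENNReal.ofReal (g (T x))) := by
    rw [← withDensity_congr_ae hsuff, Measure.withDensity_rnDeriv_eq ν μ hac]
  have hd : Measurable (fun x => ENNReal.ofReal (g (T x))) := by fun_prop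
  have hqT : Measurable fun p : E × unitInterval => q (T p.1) p.2 :=
    hq.comp ((hT.comp measurable_fst).prodMk measurable_snd)
  have hKm : Measurable fun p : E × unitInterval => K (T p.1, q (T p.1) p.2) := by fun_prop
  rw [hν, lintegral_withDensity_eq_lintegral_mul _ hd (by fun_prop),
    lintegral_withDensity_eq_lintegral_mul _ hd hKm.lintegral_prod_right']
  have := H (fun p => ENNReal.ofReal (g p.1) * K p) (by fun_prop)
  simp only [Pi.mul_apply]
  rw [this]
  refine lintegral_congr fun x => ?_
  dsimp only
  rw [lintegral_const_mul]
  exact hKm.comp measurable_prodMk_left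

/-- Law version. -/
lemma rep_law {E F : Type*} [MeasurableSpace E] [MeasurableSpace F]
    (μ : Measure E) [IsProbabilityMeasure μ]
    (T : E → F) (hT : Measurable T) 
    (φ : E → unitInterval) (hφ : Measurable φ) (q : F → unitInterval → unitInterval)
    (hq : Measurable (Function.uncurry q))
    (H : ∀ K : F × unitInterval → ℝ≥0∞, Measurable K →
        ∫⁻ x, K (T x, φ x) ∂μ = ∫⁻ x, ∫⁻ u, K (T x, q (T x) u) ∂volume ∂μ) :
    ((μ.map T).prod (volume : Measure unitInterval)).map (Function.uncurry q) = μ.map φ := by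
  refine Measure.ext_of_lintegral _ fun f hf => ?_
  have : IsProbabilityMeasure (μ.map T) := Measure.isProbabilityMeasure_map hT.aemeasurable
  have hm : Measurable fun p : F × unitInterval => f (Function.uncurry q p) := hf.comp hq
  rw [lintegral_map hf hq, lintegral_map hf hφ, lintegral_prod _ hm.aemeasurable, lintegral_map hm.lintegral_prod_right' hT]
  exact (H (fun p => f p.2) (by fun_prop)).symm

lemma rep_integral {E F : Type*} [MeasurableSpace E] [MeasurableSpace F]
    (ν : Measure E) [IsProbabilityMeasure ν]
    (T : E → F) (hT : Measurable T) 
    (φ : E → unitInterval) (hφ : Measurable φ) (q : F → unitInterval → unitInterval)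
    (hq : Measurable (Function.uncurry q))
    (H : ∀ K : F × unitInterval → ℝ≥0∞, Measurable K →
        ∫⁻ x, K (T x, φ x) ∂ν = ∫⁻ x, ∫⁻ u, K (T x, q (T x) u) ∂volume ∂ν) :
    ∫ x, (φ x : ℝ) ∂ν = ∫ t, (∫ u, (q t u : ℝ)) ∂(ν.map T) := by
  have : IsProbabilityMeasure (ν.map T) := Measure.isProbabilityMeasure_map hT.aemeasurable
  have h := rep_law ν T hT φ hφ q hq H
  have e1 : ∫ x, (φ x : ℝ) ∂ν = ∫ y, (y : ℝ) ∂(ν.map φ) := by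
    rw [integral_map hφ.aemeasurable measurable_subtype_coe.aestronglyMeasurable]
  rw [e1, ← h, integral_map hq.aemeasurable measurable_subtype_coe.aestronglyMeasurable, integral_prod]
  · rfl
  · refine Integrable.of_bound (C := 1) ((measurable_subtype_coe.comp hq).aestronglyMeasurable) ?_
    refine Eventually.of_forall fun s => ?_
    rw [Real.norm_eq_abs, abs_of_nonneg (Function.uncurry q s).2.1]
    exact (Function.uncurry q s).2.2

lemma rhoMu_eq {Ω : Type*} [MeasurableSpace Ω] (P : Measure Ω)
    (ρ : (Ω → ℝ) → ℝ) (hLI : LawInvariant P ρ)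
    {E : Type*} [MeasurableSpace E] (μ : Measure E) (f : E → ℝ) (hf : BddMeas f)
    (X : Ω → E) (hX : Measurable X) (hXμ : P.map X = μ) :
    rhoMu P ρ μ f = ρ (f ∘ X) := by
  have h : ∃ X : Ω → E, Measurable X ∧ P.map X = μ := ⟨X, hX, hXμ⟩
  rw [rhoMu, dif_pos h]
  obtain ⟨h1, h2⟩ := h.choose_spec
  obtain ⟨M, hM⟩ := hf.2
  refine hLI _ _ ⟨hf.1.comp h1, M, fun x => hM _⟩ ⟨hf.1.comp hX, M, fun x => hM _⟩ ?_
  rw [← Measure.map_map hf.1 h1, ← Measure.map_map hf.1 hX, h2, hXμ]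

lemma rho_avg {Ω : Type*} [MeasurableSpace Ω] (P : Measure Ω)
    (ρ : (Ω → ℝ) → ℝ) (hρ : IsRiskMeasure P ρ) (Z : ℕ → Ω → ℝ) (M r : ℝ)
    (hZ : ∀ j, Measurable (Z j)) (hZM : ∀ j ω, |Z j ω| ≤ M) (hr : ∀ j, ρ (Z j) = r) (n : ℕ) :
    BddMeas (fun ω => (1 / ((n + 1 : ℕ) : ℝ)) * ∑ j ∈ Finset.range (n + 1), Z j ω) ∧
    ρ (fun ω => (1 / ((n + 1 : ℕ) : ℝ)) * ∑ j ∈ Finset.range (n + 1), Z j ω) ≤ r := by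
  have hb : ∀ n : ℕ,
      BddMeas (fun ω => (1 / ((n + 1 : ℕ) : ℝ)) * ∑ j ∈ Finset.range (n + 1), Z j ω) := by
    intro n
    refine ⟨?_, M, fun ω => ?_⟩
    · exact (Finset.measurable_sum _ fun j _ => hZ j).const_mul _
    · have h1 : |∑ j ∈ Finset.range (n + 1), Z j ω| ≤ ((n + 1 : ℕ) : ℝ) * M := by
        refine (Finset.abs_sum_le_sum_abs _ _).trans ?_
        refine (Finset.sum_le_sum fun j _ => hZM j ω).trans ?_
        simp
      have hp : (0:ℝ) < ((n + 1 : ℕ) : ℝ) := by positivity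
      rw [abs_mul, abs_of_pos (by positivity), one_div, inv_mul_le_iff₀ hp]
      exact h1
  refine ⟨hb n, ?_⟩
  induction n with
  | zero => simp [← hr 0]
  | succ n ih =>
    set t : ℝ := (n + 1 : ℝ) / (n + 2) with ht
    have h0 : 0 ≤ t := by positivity
    have h1 : t ≤ 1 := by rw [ht, div_le_one (by positivity)]; linarith
    have hc := hρ.cvx _ (Z (n + 1)) t (hb n) ⟨hZ _, M, hZM _⟩ h0 h1
    have he : (fun ω => (1 / ((n + 1 + 1 : ℕ) : ℝ)) * ∑ j ∈ Finset.range (n + 1 + 1), Z j ω) =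
      (fun ω => t * ((1 / ((n + 1 : ℕ) : ℝ)) * ∑ j ∈ Finset.range (n + 1), Z j ω)
        + (1 - t) * Z (n + 1) ω) := by
      funext ω
      rw [Finset.sum_range_succ _ (n + 1), ht]
      push_cast
      have a1 : (n:ℝ) + 1 ≠ 0 := by positivity
      have a2 : (n:ℝ) + 2 ≠ 0 := by positivity
      have a3 : (n:ℝ) + 1 + 1 ≠ 0 := by positivity
      field_simp
      ring
    rw [he]
    refine hc.trans ?_
    rw [hr]
    nlinarith

lemma dilation {Ω : Type*} [MeasurableSpace Ω] [StandardBorelSpace Ω]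
    (P : Measure Ω) [IsProbabilityMeasure P] [NullSingletonClass P]
    (ρ : (Ω → ℝ) → ℝ) (hρ : IsRiskMeasure P ρ) (hLI : LawInvariant P ρ)
    {F : Type*} [MeasurableSpace F] [StandardBorelSpace F]
    (m : Measure F) [IsProbabilityMeasure m]
    (q : F → unitInterval → unitInterval)
    (hq : Measurable (Function.uncurry q)) (hm : ∀ a, Monotone (q a)) (M : ℝ) (hM : 0 < M)
    (W : Ω → ℝ) (hW : BddMeas W) (f' : F → ℝ) (hf' : BddMeas f')
    (hf'q : ∀ t, f' t = 2 * M * (∫ u, (q t u : ℝ)) - M)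
    (hlaw : P.map W = (m.prod (volume : Measure unitInterval)).map
      (fun p => 2 * M * (q p.1 p.2 : ℝ) - M)) :
    rhoMu P ρ m f' ≤ ρ W := by
  obtain ⟨V, hV, hVl⟩ := exists_law P (m.prod (volume : Measure unitInterval))
  have hτ : P.map (fun ω => (V ω).1) = m := by
    have : (fun ω => (V ω).1) = Prod.fst ∘ V := rfl
    rw [this, ← Measure.map_map measurable_fst hV, hVl]
    simp
  rw [rhoMu_eq P ρ hLI m f' hf' (fun ω => (V ω).1) (measurable_fst.comp hV) hτ]
  have hbf : BddMeas (f' ∘ fun ω => (V ω).1) :=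
    ⟨hf'.1.comp (measurable_fst.comp hV), hf'.2.imp fun _ h x => h _⟩
  have key : ∀ n : ℕ, ρ (f' ∘ fun ω => (V ω).1) ≤ ρ W + 2 * M * (1 / ((n + 1 : ℕ) : ℝ)) := by
    intro n
    have hn : 0 < n + 1 := n.succ_pos
    let R : ℕ → F × unitInterval → F × unitInterval :=
      fun j p => (p.1, rot ((j:ℝ) / ((n + 1 : ℕ) : ℝ)) p.2)
    have hRm : ∀ j, Measurable (R j) := fun j =>
      measurable_fst.prodMk ((measurable_rot _).comp measurable_snd)
    have hR : ∀ j, (m.prod (volume : Measure unitInterval)).map (R j) = m.prod volume := by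
      intro j
      have h1 : MeasurePreserving (rot ((j:ℝ) / ((n + 1 : ℕ) : ℝ))) volume volume :=
        ⟨measurable_rot _, map_rot _⟩
      exact ((MeasurePreserving.id m).prod h1).map_eq
    let G : F × unitInterval → ℝ := fun p => 2 * M * (q p.1 p.2 : ℝ) - M
    have hG : Measurable G :=
      ((measurable_subtype_coe.comp hq).const_mul _).sub_const _
    have hGb : ∀ p, |G p| ≤ M := by
      intro p
      have h0 := (q p.1 p.2).2.1
      have h1 := (q p.1 p.2).2.2
      simp only [G]
      rw [abs_le]; constructor <;> nlinarith
    let Z : ℕ → Ω → ℝ := fun j ω => G (R j (V ω))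
    have hZ : ∀ j, Measurable (Z j) := fun j => hG.comp ((hRm j).comp hV)
    have hr : ∀ j, ρ (Z j) = ρ W := by
      intro j
      refine hLI _ _ ⟨hZ j, M, fun _ => hGb _⟩ hW ?_
      rw [hlaw]
      have : Z j = G ∘ (R j ∘ V) := rfl
      rw [this, ← Measure.map_map hG ((hRm j).comp hV), ← Measure.map_map (hRm j) hV, hVl, hR]
    obtain ⟨hb, hle⟩ := rho_avg P ρ hρ Z M (ρ W) hZ (fun _ _ => hGb _) hr n
    set c := 2 * M * (1 / ((n + 1 : ℕ) : ℝ)) with hc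
    have hcash := hρ.cash _ c hb
    have hbc : BddMeas (fun ω => (1 / ((n + 1 : ℕ) : ℝ)) *
        ∑ j ∈ Finset.range (n + 1), Z j ω + c) := by
      refine ⟨hb.1.add_const _, ?_⟩
      obtain ⟨B, hB⟩ := hb.2
      exact ⟨B + |c|, fun x => (abs_add_le _ _).trans (by linarith [hB x])⟩
    refine (hρ.mono _ _ hbf hbc (Eventually.of_forall fun ω => ?_)).trans
      (by rw [hcash]; linarith)
    have hav := rot_avg (n + 1) hn (q (V ω).1) (hm _) (V ω).2
    have hs : (1 / ((n + 1 : ℕ) : ℝ)) * ∑ j ∈ Finset.range (n + 1), Z j ω =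
      2 * M * ((1 / ((n + 1 : ℕ) : ℝ)) * ∑ j ∈ Finset.range (n + 1),
        (q (V ω).1 (rot ((j:ℝ) / ((n + 1 : ℕ) : ℝ)) (V ω).2) : ℝ)) - M := by
      simp only [Z, G, R]
      rw [Finset.sum_sub_distrib, ← Finset.mul_sum]
      have : ((n + 1 : ℕ) : ℝ) ≠ 0 := by positivity
      simp only [Finset.sum_const, Finset.card_range, nsmul_eq_mul]
      field_simp
    rw [hs]
    simp only [Function.comp, hf'q, hc]
    have h1 := (abs_le.1 hav).1
    nlinarith
  have hlim : Tendsto (fun n : ℕ => ρ W + 2 * M * (1 / ((n + 1 : ℕ) : ℝ))) atTop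
      (𝓝 (ρ W + 2 * M * 0)) := by
    have := tendsto_one_div_add_atTop_nhds_zero_nat (𝕜 := ℝ)
    refine (this.const_mul (2 * M)).const_add (ρ W) |>.congr fun n => ?_
    push_cast; rfl
  have := ge_of_tendsto' hlim key
  simpa using this

/-- Sufficient statistics preserve divergences: if `ν ≪ μ` and `T : E → F` is
measurable with `dν/dμ = g ∘ T` μ-a.e. for some measurable `g : F → ℝ`, then
`α(ν∘T⁻¹ | μ∘T⁻¹) = α(ν|μ)`. -/
theorem statement17 {Ω : Type*} [MeasurableSpace Ω] [StandardBorelSpace Ω]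
    (P : Measure Ω) [IsProbabilityMeasure P] [NullSingletonClass P]
    (ρ : (Ω → ℝ) → ℝ) (hρ : IsRiskMeasure P ρ) (hLI : LawInvariant P ρ)
    (E : Type) [TopologicalSpace E] [MeasurableSpace E] [PolishSpace E] [BorelSpace E]
    (F : Type) [TopologicalSpace F] [MeasurableSpace F] [PolishSpace F] [BorelSpace F]
    (μ ν : Measure E) [IsProbabilityMeasure μ] [IsProbabilityMeasure ν] (hac : ν ≪ μ)
    (T : E → F) (hT : Measurable T)
    (hsuff : ∃ g : F → ℝ, Measurable g ∧
      ∀ᵐ x ∂μ, ν.rnDeriv μ x = ENNReal.ofReal (g (T x))) :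
    divergence P ρ (ν.map T) (μ.map T) = divergence P ρ ν μ := by
  have : IsProbabilityMeasure (μ.map T) := Measure.isProbabilityMeasure_map hT.aemeasurable
  have : IsProbabilityMeasure (ν.map T) := Measure.isProbabilityMeasure_map hT.aemeasurable
  obtain ⟨X, hX, hXl⟩ := exists_law P μ
  obtain ⟨g, hg, hgs⟩ := hsuff
  apply le_antisymm
  · refine iSup₂_le fun f hf => ?_
    have hfT : BddMeas (f ∘ T) := ⟨hf.1.comp hT, hf.2.imp fun _ h x => h _⟩
    refine le_trans (le_of_eq ?_) (le_iSup₂ (f ∘ T) hfT)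
    rw [rhoMu_eq P ρ hLI μ (f ∘ T) hfT X hX hXl,
      rhoMu_eq P ρ hLI (μ.map T) f hf (T ∘ X) (hT.comp hX)
        (by rw [← Measure.map_map hT hX, hXl]),
      integral_map hT.aemeasurable hf.1.aestronglyMeasurable]
    rfl
  · refine iSup₂_le fun f hf => ?_
    obtain ⟨M0, hM0⟩ := hf.2
    let M : ℝ := max M0 1
    have hM : 0 < M := lt_of_lt_of_le one_pos (le_max_right _ _)
    have hfM : ∀ x, |f x| ≤ M := fun x => (hM0 x).trans (le_max_left _ _)
    let φ : E → unitInterval := fun x => ⟨(f x + M) / (2 * M), by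
      have := abs_le.1 (hfM x)
      exact div_nonneg (by linarith) (by linarith), by
      have := abs_le.1 (hfM x)
      rw [div_le_one (by linarith)]; linarith⟩
    have hφ : Measurable φ := ((hf.1.add_const _).div_const _).subtype_mk
    have hfφ : ∀ x, f x = 2 * M * (φ x : ℝ) - M := by
      intro x
      simp only [φ]
      field_simp
      ring
    obtain ⟨q, hq, hm, H⟩ := exists_quantile_rep μ T hT φ hφ
    have Hν := rep_nu μ ν hac T hT g hg hgs φ hφ q hq H
    have hintg := rep_integral ν T hT φ hφ q hq Hν
    have hlaw := rep_law μ T hT φ hφ q hq H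
    let f' : F → ℝ := fun t => 2 * M * (∫ u, (q t u : ℝ)) - M
    have hI : ∀ t, 0 ≤ ∫ u, (q t u : ℝ) ∧ ∫ u, (q t u : ℝ) ≤ 1 := by
      intro t
      refine ⟨integral_nonneg fun u => (q t u).2.1, ?_⟩
      calc ∫ u, (q t u : ℝ) ≤ ∫ u : unitInterval, (1:ℝ) :=
            integral_mono_of_nonneg (Eventually.of_forall fun u => (q t u).2.1)
              (integrable_const _) (Eventually.of_forall fun u => (q t u).2.2)
        _ = 1 := by simp
    have hIm : Measurable fun t => ∫ u, (q t u : ℝ) := by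
      have : StronglyMeasurable (fun p : F × unitInterval => (q p.1 p.2 : ℝ)) :=
        (measurable_subtype_coe.comp hq).stronglyMeasurable
      exact this.integral_prod_right'.measurable
    have hf' : BddMeas f' := by
      refine ⟨(hIm.const_mul _).sub_const _, M, fun t => ?_⟩
      obtain ⟨h0, h1⟩ := hI t
      simp only [f']
      rw [abs_le]; constructor <;> nlinarith
    refine le_trans (ENNReal.ofReal_le_ofReal ?_) (le_iSup₂ (f := fun (f : F → ℝ) (_ : BddMeas f) =>
      ENNReal.ofReal ((∫ x, f x ∂(ν.map T)) - rhoMu P ρ (μ.map T) f)) f' hf')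
    have hd := dilation P ρ hρ hLI (μ.map T) q hq hm M hM (f ∘ X)
      ⟨hf.1.comp hX, M, fun _ => hfM _⟩ f' hf' (fun _ => rfl) (by
        have h1 : (fun p : F × unitInterval => 2 * M * (q p.1 p.2 : ℝ) - M)
          = (fun y : unitInterval => 2 * M * (y : ℝ) - M) ∘ Function.uncurry q := rfl
        have h2 : f = (fun y : unitInterval => 2 * M * (y : ℝ) - M) ∘ φ := funext hfφ
        have h3 : Measurable (fun y : unitInterval => 2 * M * (y : ℝ) - M) := by fun_prop
        rw [← Measure.map_map hf.1 hX, hXl, h1, ← Measure.map_map h3 hq, hlaw,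
          Measure.map_map h3 hφ, ← h2])
    rw [rhoMu_eq P ρ hLI μ f hf X hX hXl]
    have hii : ∫ x, f x ∂ν = ∫ t, f' t ∂(ν.map T) := by
      have i1 : Integrable (fun x => (φ x : ℝ)) ν := by
        refine Integrable.of_bound (C := 1)
          ((measurable_subtype_coe.comp hφ).aestronglyMeasurable) ?_
        refine Eventually.of_forall fun s => ?_
        rw [Real.norm_eq_abs, abs_of_nonneg (φ s).2.1]
        exact (φ s).2.2
      have i2 : Integrable (fun t => ∫ u, (q t u : ℝ)) (ν.map T) := by
        refine Integrable.of_bound (C := 1) hIm.aestronglyMeasurable ?_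
        refine Eventually.of_forall fun s => ?_
        rw [Real.norm_eq_abs, abs_of_nonneg (hI s).1]
        exact (hI s).2
      simp only [hfφ, f']
      rw [integral_sub (i1.const_mul _) (integrable_const _),
        integral_sub (i2.const_mul _) (integrable_const _), integral_const_mul,
        integral_const_mul, hintg]
      simp
    rw [hii]
    linarith

end RiskDiv
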